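/- (Combinatorial core of Proposition 4.2, the analogue of the Coding Theorem) Let ℓ : ℕ → ℕ satisfy ∑_{i} 2^{-ℓ(i)} ≤ 1 (the sum taken in the extended nonnegative reals). Then there exists a family of binary strings z : ℕ → List Bool such that: (a) |z(i)| = ℓ(i) + 2 for every i; (b) for every i, Γ_{z(i)} is contained in the half-open interval [∑_{k<i} 2^{-ℓ(k)}, ∑_{k≤i} 2^{-ℓ(k)}); and (c) for all i ≠ j, z(i) is not a prefix of z(j). In particular z is injective and its range is prefix-free. -/

import Mathlib

open scoped ENNReal

def PrefixFree (S : Set (List Bool)) : Prop :=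
  ∀ s ∈ S, ∀ t ∈ S, s <+: t → s = t

noncomputable def strVal (z : List Bool) : ℝ :=
  ∑ i ∈ Finset.range z.length, if z.getD i false then (2 : ℝ)⁻¹ ^ (i + 1) else 0

noncomputable def Gamma (z : List Bool) : Set ℝ :=
  Set.Ico (strVal z) (strVal z + (2 : ℝ)⁻¹ ^ z.length)

theorem strVal_nil : strVal [] = 0 := by simp [strVal]

theorem strVal_cons (b : Bool) (z : List Bool) :
    strVal (b :: z) = (if b then 2⁻¹ else 0) + 2⁻¹ * strVal z := by
  unfold strVal
  rw [List.length_cons, Finset.sum_range_succ', Finset.mul_sum, add_comm]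
  congr 1
  · simp
  · refine Finset.sum_congr rfl fun i _ => ?_
    rw [List.getD_cons_succ]
    split_ifs <;> ring

theorem strVal_nonneg (z : List Bool) : 0 ≤ strVal z :=
  Finset.sum_nonneg fun i _ => by split_ifs <;> positivity

theorem strVal_lt_one (z : List Bool) : strVal z < 1 := by
  induction z with
  | nil => simp [strVal_nil]
  | cons b z ih =>
    rw [strVal_cons]
    split_ifs <;> linarith

theorem strVal_append (s t : List Bool) :
    strVal (s ++ t) = strVal s + 2⁻¹ ^ s.length * strVal t := by
  induction s with
  | nil => simp [strVal_nil]
  | cons b s ih =>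
    rw [List.cons_append, strVal_cons, strVal_cons, ih, List.length_cons]
    ring

theorem strVal_mem_Gamma_of_prefix {s t : List Bool} (h : s <+: t) : strVal t ∈ Gamma s := by
  obtain ⟨r, rfl⟩ := h
  rw [Gamma, strVal_append]
  have hp : (0 : ℝ) < 2⁻¹ ^ s.length := by positivity
  constructor
  · nlinarith [strVal_nonneg r]
  · nlinarith [strVal_lt_one r]

/-- Every dyadic rational `c / 2 ^ n` in `[0, 1)` is the value of a string of length `n`. -/
theorem exists_strVal_eq (n : ℕ) :
    ∀ c : ℕ, c < 2 ^ n → ∃ z : List Bool, z.length = n ∧ strVal z = c * (2 : ℝ)⁻¹ ^ n := by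
  induction n with
  | zero =>
    intro c hc
    obtain rfl : c = 0 := by simpa using hc
    exact ⟨[], rfl, by simp [strVal_nil]⟩
  | succ n ih =>
    intro c hc
    rw [pow_succ] at hc
    rcases lt_or_ge c (2 ^ n) with h | h
    · obtain ⟨z, hz, hv⟩ := ih c h
      refine ⟨false :: z, by simp [hz], ?_⟩
      rw [strVal_cons, hv]
      simp only [Bool.false_eq_true, if_false]
      ring
    · obtain ⟨z, hz, hv⟩ := ih (c - 2 ^ n) (by omega)
      refine ⟨true :: z, by simp [hz], ?_⟩
      have hp : (2 : ℝ) ^ n * 2⁻¹ ^ n = 1 := by rw [← mul_pow]; norm_num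
      rw [strVal_cons, hv, Nat.cast_sub h]
      push_cast
      simp only [if_true]
      linear_combination -(2⁻¹ : ℝ) * hp

/-- An interval `[a, a + 2 ^ (-l))` inside `[0, 1)` contains `Γ_z` for some `z` of length `l + 2`. -/
theorem exists_Gamma_subset_Ico {a : ℝ} {l : ℕ} (ha : 0 ≤ a) (hal : a + (2 : ℝ)⁻¹ ^ l ≤ 1) :
    ∃ z : List Bool, z.length = l + 2 ∧ Gamma z ⊆ Set.Ico a (a + (2 : ℝ)⁻¹ ^ l) := by
  have hp : (0 : ℝ) < 2⁻¹ ^ (l + 2) := by positivity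
  have hl : (2 : ℝ)⁻¹ ^ l = 4 * 2⁻¹ ^ (l + 2) := by ring
  have hm : (2 : ℝ) ^ (l + 2) * 2⁻¹ ^ (l + 2) = 1 := by rw [← mul_pow]; norm_num
  have hge := Nat.le_ceil (a * 2 ^ (l + 2))
  have hlt := Nat.ceil_lt_add_one (a := a * 2 ^ (l + 2)) (by positivity)
  set c := ⌈a * 2 ^ (l + 2)⌉₊
  have hge' : a ≤ c * (2 : ℝ)⁻¹ ^ (l + 2) := by
    have := mul_le_mul_of_nonneg_right hge hp.le
    rwa [mul_assoc, hm, mul_one] at this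
  have hlt' : c * (2 : ℝ)⁻¹ ^ (l + 2) < a + 2⁻¹ ^ (l + 2) := by
    have := mul_lt_mul_of_pos_right hlt hp
    rwa [add_mul, mul_assoc, hm, mul_one, one_mul] at this
  have hc : c < 2 ^ (l + 2) := by
    have h : (c : ℝ) < 2 ^ (l + 2) := by
      refine lt_of_mul_lt_mul_right ?_ hp.le
      rw [hm]
      linarith
    exact_mod_cast h
  obtain ⟨z, hz, hv⟩ := exists_strVal_eq _ c hc
  refine ⟨z, hz, ?_⟩
  rw [Gamma, hz, hv]
  exact Set.Ico_subset_Ico hge' (by linarith)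

theorem sum_inv_two_pow_le_one {ℓ : ℕ → ℕ} (hℓ : ∑' i : ℕ, (2 : ℝ≥0∞)⁻¹ ^ ℓ i ≤ 1)
    (s : Finset ℕ) : ∑ k ∈ s, (2 : ℝ)⁻¹ ^ ℓ k ≤ 1 := by
  have h := ENNReal.toReal_mono ENNReal.one_ne_top ((ENNReal.sum_le_tsum s).trans hℓ)
  rw [ENNReal.toReal_sum fun k _ => by finiteness] at h
  simpa using h

theorem coding_combinatorial (ℓ : ℕ → ℕ)
    (hℓ : ∑' i : ℕ, (2 : ℝ≥0∞)⁻¹ ^ ℓ i ≤ 1) :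
    ∃ z : ℕ → List Bool,
      (∀ i, (z i).length = ℓ i + 2) ∧
      (∀ i, Gamma (z i) ⊆
        Set.Ico (∑ k ∈ Finset.range i, (2 : ℝ)⁻¹ ^ ℓ k)
                (∑ k ∈ Finset.range (i + 1), (2 : ℝ)⁻¹ ^ ℓ k)) ∧
      (∀ i j, i ≠ j → ¬ z i <+: z j) ∧
      Function.Injective z ∧ PrefixFree (Set.range z) := by
  have hmono : Monotone fun i => ∑ k ∈ Finset.range i, (2 : ℝ)⁻¹ ^ ℓ k :=
    monotone_nat_of_le_succ fun i => by
      rw [Finset.sum_range_succ]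
      exact le_add_of_nonneg_right (by positivity)
  have hex : ∀ i, ∃ z : List Bool, z.length = ℓ i + 2 ∧ Gamma z ⊆
      Set.Ico (∑ k ∈ Finset.range i, (2 : ℝ)⁻¹ ^ ℓ k)
        (∑ k ∈ Finset.range (i + 1), (2 : ℝ)⁻¹ ^ ℓ k) := fun i => by
    have h := sum_inv_two_pow_le_one hℓ (Finset.range (i + 1))
    rw [Finset.sum_range_succ] at h ⊢
    exact exists_Gamma_subset_Ico (Finset.sum_nonneg fun _ _ => by positivity) h
  choose z hlen hsub using hex
  have hpre : ∀ i j, z i <+: z j → i = j := fun i j h => by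
    by_contra hij
    exact Set.disjoint_left.mp (hmono.pairwise_disjoint_on_Ico_succ hij)
      (hsub i (strVal_mem_Gamma_of_prefix h))
      (hsub j (strVal_mem_Gamma_of_prefix List.prefix_rfl))
  refine ⟨z, hlen, hsub, fun i j hij h => hij (hpre i j h),
    fun i j h => hpre i j (h ▸ List.prefix_rfl), ?_⟩
  rintro _ ⟨i, rfl⟩ _ ⟨j, rfl⟩ h
  rw [hpre i j h]
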